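/- Define S_m = D((t_{m+1}+t_{m-1}−3)/2) − D((t_m+t_{m-2}−3)/2) for m≥7. Then for every m≥10, S_m = S_{m-1} + S_{m-2} + S_{m-3} + (t_{m-2}−3t_{m-4}−1)/2. -/

import Mathlib

/-- The three-letter alphabet of the Tribonacci word. -/
inductive TLetter : Type
  | a | b | c
deriving DecidableEq

/-- The Tribonacci substitution σ(a)=ab, σ(b)=ac, σ(c)=a. -/
def tsubst : TLetter → List TLetter
  | .a => [.a, .b]
  | .b => [.a, .c]
  | .c => [.a]

/-- `Tword m = σ^m(a)`, the m-th finite Tribonacci word. -/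
def Tword : ℕ → List TLetter
  | 0 => [.a]
  | n + 1 => (Tword n).flatMap tsubst

/-- The prefix 𝕋[1,n] of the Tribonacci word of length n
(each `Tword n` is a prefix of the next and has length ≥ n). -/
def TPrefix (n : ℕ) : List TLetter := (Tword n).take n

/-- A word is a factor of the Tribonacci word 𝕋. -/
def IsFactorT (w : List TLetter) : Prop := ∃ m, w <:+: Tword m

/-- `tribAux i = t_{i-2}`: Tribonacci numbers, shifted so that the index is a natural. -/
def tribAux : ℕ → ℕ
  | 0 => 0
  | 1 => 1
  | 2 => 1
  | n + 3 => tribAux (n + 2) + tribAux (n + 1) + tribAux n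

/-- The Tribonacci numbers `t m` for `m : ℤ`: t₋₂=0, t₋₁=1, t₀=1,
`t m = t (m-1) + t (m-2) + t (m-3)` for m ≥ 1. (Junk value 0 below -2.) -/
def t (m : ℤ) : ℕ := tribAux (m + 2).toNat

/-- Kernel numbers: k₀=0, k₁=k₂=1, `k m = k (m-1) + k (m-2) + k (m-3) - 1` for m ≥ 3. -/
def kAux : ℕ → ℕ
  | 0 => 0
  | 1 => 1
  | 2 => 1
  | n + 3 => kAux (n + 2) + kAux (n + 1) + kAux n - 1

def kker (m : ℤ) : ℕ := kAux m.toNat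

/-- `A n`: the number of distinct nonempty words w with ww a factor of 𝕋[1,n]. -/
noncomputable def A (n : ℕ) : ℕ := Nat.card {w : List TLetter // w ≠ [] ∧ (w ++ w) <:+: TPrefix n}

/-- `B n`: the number of occurrences of squares in 𝕋[1,n], i.e. of pairs (w,i) with
w nonempty, i ≥ 1, ww occurring in 𝕋 at position i and i + 2|w| - 1 ≤ n. -/
noncomputable def B (n : ℕ) : ℕ :=
  Nat.card {p : List TLetter × ℕ // p.1 ≠ [] ∧ 1 ≤ p.2 ∧
    p.2 + 2 * p.1.length - 1 ≤ n ∧ (p.1 ++ p.1) <+: (TPrefix n).drop (p.2 - 1)}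

/-- `C n`: the number of distinct nonempty words w with www a factor of 𝕋[1,n]. -/
noncomputable def C (n : ℕ) : ℕ := Nat.card {w : List TLetter // w ≠ [] ∧ (w ++ w ++ w) <:+: TPrefix n}

/-- `D n`: the number of occurrences of cubes in 𝕋[1,n], i.e. of pairs (w,i) with
w nonempty, i ≥ 1, www occurring in 𝕋 at position i and i + 3|w| - 1 ≤ n. -/
noncomputable def D (n : ℕ) : ℕ :=
  Nat.card {p : List TLetter × ℕ // p.1 ≠ [] ∧ 1 ≤ p.2 ∧
    p.2 + 3 * p.1.length - 1 ≤ n ∧ (p.1 ++ p.1 ++ p.1) <+: (TPrefix n).drop (p.2 - 1)}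

/-- S_m = D((t_{m+1}+t_{m-1}-3)/2) - D((t_m+t_{m-2}-3)/2). -/
noncomputable def S (m : ℤ) : ℚ :=
  (D ((t (m + 1) + t (m - 1) - 3) / 2) : ℚ) - (D ((t m + t (m - 2) - 3) / 2) : ℚ)

/-- The Tribonacci word as an infinite sequence, indexed from `0`. -/
def tribWord (i : ℕ) : TLetter := (Tword i).getD i .a

/-- `substLen n` is the length of the image under `tsubst` of the prefix of length `n`. -/
def substLen : ℕ → ℕ
  | 0 => 0
  | n + 1 => substLen n + (tsubst (tribWord n)).length

/-- The factor of length `l` at position `x` of the Tribonacci word. -/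
def tribFactor (x l : ℕ) : List TLetter := (List.range l).map fun j => tribWord (x + j)

/-- The factor of the Tribonacci word occupying positions `s, …, r - 1` has period `p`. -/
def HasPeriodOn (s r p : ℕ) : Prop := ∀ j, s ≤ j → j + p < r → tribWord j = tribWord (j + p)

/-- The lengths of the palindromic prefixes of the Tribonacci word. -/
def palLen (i : ℕ) : ℕ := (tribAux (i + 3) + tribAux (i + 1) - 3) / 2

/-! ### The infinite word -/

lemma length_tribFactor (x l : ℕ) : (tribFactor x l).length = l := by simp [tribFactor]

lemma Tword_isPrefix_succ (n : ℕ) : Tword n <+: Tword (n + 1) := by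
  induction n with
  | zero => exact ⟨[.b], rfl⟩
  | succ n ih =>
    obtain ⟨u, hu⟩ := ih
    refine ⟨u.flatMap tsubst, ?_⟩
    change (Tword n).flatMap tsubst ++ _ = (Tword (n + 1)).flatMap tsubst
    rw [← hu, List.flatMap_append]

lemma Tword_isPrefix {m n : ℕ} (h : m ≤ n) : Tword m <+: Tword n := by
  induction n, h using Nat.le_induction with
  | base => exact List.prefix_rfl
  | succ n _ ih => exact ih.trans (Tword_isPrefix_succ n)

lemma length_le_length_flatMap_tsubst (w : List TLetter) :
    w.length ≤ (w.flatMap tsubst).length := by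
  induction w with
  | nil => simp
  | cons x w ih => cases x <;> simp [tsubst] at ih ⊢ <;> omega

lemma Tword_eq_cons (n : ℕ) : ∃ u, Tword n = .a :: u := by
  obtain ⟨u, hu⟩ := Tword_isPrefix (Nat.zero_le n)
  exact ⟨u, by rw [← hu]; rfl⟩

lemma lt_length_Tword (n : ℕ) : n < (Tword n).length := by
  induction n with
  | zero => simp [Tword]
  | succ n ih =>
    obtain ⟨u, hu⟩ := Tword_eq_cons n
    have := length_le_length_flatMap_tsubst u
    simp only [Tword, hu, List.flatMap_cons, tsubst, List.length_append, List.length_cons,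
      List.length_nil] at ih ⊢
    omega

lemma Tword_getElem {n i : ℕ} (h : i < (Tword n).length) : (Tword n)[i] = tribWord i := by
  have hi := lt_length_Tword i
  rw [tribWord, List.getD_eq_getElem _ _ hi]
  rcases le_total n i with hn | hn
  · exact (Tword_isPrefix hn).getElem h
  · exact ((Tword_isPrefix hn).getElem hi).symm

lemma eq_tribFactor_of_isPrefix {w : List TLetter} {n : ℕ} (h : w <+: Tword n) :
    w = tribFactor 0 w.length := by
  refine List.ext_getElem (by simp [tribFactor]) fun i h1 h2 => ?_
  rw [h.getElem h1, Tword_getElem]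
  simp [tribFactor]

lemma tribFactor_prefix_Tword (n : ℕ) : tribFactor 0 n <+: Tword n := by
  have h : (Tword n).take n <+: Tword n := ⟨_, List.take_append_drop _ _⟩
  have h2 := eq_tribFactor_of_isPrefix h
  rw [List.length_take, min_eq_left (lt_length_Tword n).le] at h2
  rwa [← h2]

lemma TPrefix_eq (n : ℕ) : TPrefix n = tribFactor 0 n := by
  have h2 := eq_tribFactor_of_isPrefix ⟨_, List.take_append_drop n (Tword n)⟩
  rwa [List.length_take, min_eq_left (lt_length_Tword n).le] at h2

lemma tribFactor_succ (x l : ℕ) : tribFactor x (l + 1) = tribFactor x l ++ [tribWord (x + l)] := by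
  simp [tribFactor, List.range_succ]

lemma flatMap_tribFactor (n : ℕ) :
    (tribFactor 0 n).flatMap tsubst = tribFactor 0 (substLen n) := by
  have hlen : ((tribFactor 0 n).flatMap tsubst).length = substLen n := by
    induction n with
    | zero => rfl
    | succ n ih =>
      rw [tribFactor_succ, List.flatMap_append, List.length_append, ih]
      simp [substLen]
  obtain ⟨u, hu⟩ := tribFactor_prefix_Tword n
  have h : (tribFactor 0 n).flatMap tsubst <+: Tword (n + 1) := by
    refine ⟨u.flatMap tsubst, ?_⟩
    rw [← List.flatMap_append, hu]
    rfl
  rw [← hlen]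
  exact eq_tribFactor_of_isPrefix h

lemma tsubst_tribWord (n : ℕ) :
    tsubst (tribWord n) = tribFactor (substLen n) (tsubst (tribWord n)).length := by
  have h := flatMap_tribFactor (n + 1)
  rw [tribFactor_succ, List.flatMap_append, flatMap_tribFactor] at h
  have h2 : tribFactor 0 (substLen (n + 1)) = tribFactor 0 (substLen n) ++
      tribFactor (substLen n) (tsubst (tribWord n)).length := by
    simp [tribFactor, substLen, List.range_add]
  rw [h2] at h
  simpa using List.append_cancel_left h

lemma tribWord_substLen (n : ℕ) : tribWord (substLen n) = .a := by
  have h := tsubst_tribWord n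
  cases hn : tribWord n <;> simp [hn, tsubst, tribFactor, List.range_succ] at h <;> simp [h]

lemma block_of_eq_a {n : ℕ} (hn : tribWord n = .a) :
    substLen (n + 1) = substLen n + 2 ∧ tribWord (substLen n + 1) = .b := by
  have h := tsubst_tribWord n
  simp only [hn, tsubst, tribFactor, List.range_succ, List.length_cons, List.length_nil] at h
  simp at h
  exact ⟨by simp [substLen, hn, tsubst], h.2.symm⟩

lemma block_of_eq_b {n : ℕ} (hn : tribWord n = .b) :
    substLen (n + 1) = substLen n + 2 ∧ tribWord (substLen n + 1) = .c := by
  have h := tsubst_tribWord n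
  simp only [hn, tsubst, tribFactor, List.range_succ, List.length_cons, List.length_nil] at h
  simp at h
  exact ⟨by simp [substLen, hn, tsubst], h.2.symm⟩

lemma block_of_eq_c {n : ℕ} (hn : tribWord n = .c) :
    substLen (n + 1) = substLen n + 1 ∧ tribWord (substLen n + 1) = .a := by
  have h : substLen (n + 1) = substLen n + 1 := by simp [substLen, hn, tsubst]
  exact ⟨h, h ▸ tribWord_substLen (n + 1)⟩

lemma substLen_succ_eq (n : ℕ) :
    substLen (n + 1) = substLen n + 1 ∨ substLen (n + 1) = substLen n + 2 := by
  cases hn : tribWord n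
  · exact .inr (block_of_eq_a hn).1
  · exact .inr (block_of_eq_b hn).1
  · exact .inl (block_of_eq_c hn).1

lemma substLen_strictMono : StrictMono substLen :=
  strictMono_nat_of_lt_succ fun n => by have := substLen_succ_eq n; omega

lemma tribWord_eq_of_second_eq {i j : ℕ}
    (h : tribWord (substLen i + 1) = tribWord (substLen j + 1)) : tribWord i = tribWord j := by
  cases hi : tribWord i <;> cases hj : tribWord j <;>
    first
    | rfl
    | (exfalso
       first
       | have h1 := (block_of_eq_a hi).2
       | have h1 := (block_of_eq_b hi).2
       | have h1 := (block_of_eq_c hi).2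
       first
       | have h2 := (block_of_eq_a hj).2
       | have h2 := (block_of_eq_b hj).2
       | have h2 := (block_of_eq_c hj).2
       rw [h1, h2] at h
       cases h)

lemma substLen_succ_eq_of_eq {i j : ℕ} (h : tribWord i = tribWord j) :
    substLen (i + 1) + substLen j = substLen (j + 1) + substLen i := by
  simp only [substLen, h]
  omega

lemma exists_block (j : ℕ) : ∃ n, substLen n ≤ j ∧ j < substLen (n + 1) := by
  induction j with
  | zero => exact ⟨0, le_rfl, by have := substLen_succ_eq 0; omega⟩
  | succ j ih =>
    obtain ⟨n, h1, h2⟩ := ih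
    by_cases h : j + 1 < substLen (n + 1)
    · exact ⟨n, by omega, h⟩
    · exact ⟨n + 1, by omega, by have := substLen_succ_eq (n + 1); omega⟩

lemma tribWord_eq_a_iff (j : ℕ) : tribWord j = .a ↔ ∃ n, j = substLen n := by
  refine ⟨fun h => ?_, fun ⟨n, hn⟩ => hn ▸ tribWord_substLen n⟩
  obtain ⟨n, h1, h2⟩ := exists_block j
  rcases Nat.eq_or_lt_of_le h1 with h3 | h3
  · exact ⟨n, h3.symm⟩
  · exfalso
    cases hn : tribWord n
    · have := block_of_eq_a hn
      obtain rfl : j = substLen n + 1 := by omega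
      simp [this.2] at h
    · have := block_of_eq_b hn
      obtain rfl : j = substLen n + 1 := by omega
      simp [this.2] at h
    · have := block_of_eq_c hn
      omega

lemma tribWord_succ_of_ne_a {j : ℕ} (h : tribWord j ≠ .a) : tribWord (j + 1) = .a := by
  obtain ⟨n, h1, h2⟩ := exists_block j
  have h3 : substLen n ≠ j := fun h3 => h (h3 ▸ tribWord_substLen n)
  have h4 := substLen_succ_eq n
  rw [tribWord_eq_a_iff]
  exact ⟨n + 1, by omega⟩

lemma substLen_add_two (n : ℕ) : substLen n + 3 ≤ substLen (n + 2) := by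
  have h1 := substLen_succ_eq n
  have h2 := substLen_succ_eq (n + 1)
  simp only [add_assoc, Nat.reduceAdd] at h2
  cases hn : tribWord n
  · have := block_of_eq_a hn
    omega
  · have := block_of_eq_b hn
    omega
  · have h3 := tribWord_succ_of_ne_a (j := n) (by simp [hn])
    have := block_of_eq_a h3
    simp only [add_assoc, Nat.reduceAdd] at this
    omega

lemma not_three_equal (j : ℕ) :
    ¬ (tribWord j = tribWord (j + 1) ∧ tribWord (j + 1) = tribWord (j + 2)) := by
  rintro ⟨h1, h2⟩
  by_cases ha : tribWord j = .a
  · obtain ⟨x, hx⟩ := (tribWord_eq_a_iff _).1 ha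
    obtain ⟨y, hy⟩ := (tribWord_eq_a_iff _).1 (h1 ▸ ha)
    obtain ⟨z, hz⟩ := (tribWord_eq_a_iff _).1 (h2 ▸ h1 ▸ ha)
    have hxy : x < y := substLen_strictMono.lt_iff_lt.1 (by omega)
    have hyz : y < z := substLen_strictMono.lt_iff_lt.1 (by omega)
    have := substLen_add_two x
    have := substLen_strictMono.monotone (show x + 2 ≤ z by omega)
    omega
  · exact ha (h1.trans (tribWord_succ_of_ne_a ha))

/-! ### Periods and the substitution -/

lemma HasPeriodOn.substLen_add {s r p P : ℕ} (h : HasPeriodOn s r p)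
    (hP : substLen (s + p) = substLen s + P) {i : ℕ} (hs : s ≤ i) (hi : i + p ≤ r) :
    substLen (i + p) = substLen i + P := by
  induction i, hs using Nat.le_induction with
  | base => exact hP
  | succ i hs ih =>
    have h1 := ih (by omega)
    have h2 := substLen_succ_eq_of_eq (h i hs (by omega))
    rw [show i + 1 + p = i + p + 1 by omega]
    omega

lemma HasPeriodOn.map_subst {s r p P : ℕ} (h : HasPeriodOn s r p)
    (hP : substLen (s + p) = substLen s + P) :
    HasPeriodOn (substLen s) (substLen r + 1) P := by
  intro j hj hr
  obtain ⟨i, h1, h2⟩ := exists_block j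
  have hsi : s ≤ i := by
    have := substLen_strictMono.lt_iff_lt.1 (hj.trans_lt h2)
    omega
  have hsp : s + p ≤ r := substLen_strictMono.le_iff_le.1 (by omega)
  have hir : i + p ≤ r := by
    by_contra hc
    have h3 := h.substLen_add hP (i := r - p) (by omega) (by omega)
    rw [Nat.sub_add_cancel (by omega)] at h3
    have := substLen_strictMono (show r - p < i by omega)
    omega
  have h3 := h.substLen_add hP hsi hir
  have h4 := substLen_succ_eq i
  rcases Nat.eq_or_lt_of_le h1 with h5 | h5
  · rw [← h5, ← h3, tribWord_substLen, tribWord_substLen]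
  · obtain rfl : j = substLen i + 1 := by omega
    have h6 : i + p < r := substLen_strictMono.lt_iff_lt.1 (by omega)
    have h7 := h i hsi h6
    rw [show substLen i + 1 + P = substLen (i + p) + 1 by omega]
    cases hc : tribWord i
    · rw [(block_of_eq_a hc).2, (block_of_eq_a (h7 ▸ hc)).2]
    · rw [(block_of_eq_b hc).2, (block_of_eq_b (h7 ▸ hc)).2]
    · rw [(block_of_eq_c hc).2, (block_of_eq_c (h7 ▸ hc)).2]

/-- A factor of period `p` that is at most one letter short of a cube is covered by the image
of a factor with the same property. -/
lemma HasPeriodOn.exists_desubst {s r p : ℕ} (h : HasPeriodOn s r p) (hp : 2 ≤ p)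
    (hr : s + 3 * p ≤ r + 1) :
    ∃ s' r' q, 1 ≤ q ∧ HasPeriodOn s' r' q ∧ s' + 3 * q ≤ r' + 1 ∧ substLen s' ≤ s ∧
      r ≤ substLen r' + 1 ∧ (∀ i < r', substLen i + 1 < r) ∧
      ∀ i, s' ≤ i → i + q ≤ r' → substLen (i + q) = substLen i + p := by
  classical
  obtain ⟨s', hs1, hs2⟩ := exists_block s
  have hex : ∃ r', r ≤ substLen r' + 1 :=
    ⟨r, by have := substLen_strictMono.le_apply (x := r); omega⟩
  obtain ⟨r', hr1, hr2⟩ : ∃ r', r ≤ substLen r' + 1 ∧ ∀ i < r', substLen i + 1 < r :=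
    ⟨Nat.find hex, Nat.find_spec hex, fun i hi => by have := Nat.find_min hex hi; omega⟩
  have hb := substLen_succ_eq s'
  obtain ⟨i₀, hi1, hi2, hi3⟩ : ∃ i₀, s ≤ substLen i₀ ∧ substLen i₀ ≤ s + 1 ∧
      (i₀ = s' ∨ i₀ = s' + 1 ∧ s = substLen s' + 1) := by
    by_cases hc : s = substLen s'
    · exact ⟨s', by omega, by omega, .inl rfl⟩
    · exact ⟨s' + 1, by omega, by omega, .inr ⟨rfl, by omega⟩⟩
  obtain ⟨n₀, hn₀⟩ : ∃ n, substLen i₀ + p = substLen n := by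
    rw [← tribWord_eq_a_iff, ← h _ hi1 (by omega), tribWord_substLen]
  have hlt : i₀ < n₀ := substLen_strictMono.lt_iff_lt.1 (by omega)
  obtain ⟨q, rfl⟩ : ∃ q, n₀ = i₀ + q := ⟨n₀ - i₀, by omega⟩
  have hi₀r : i₀ + q ≤ r' := substLen_strictMono.le_iff_le.1 (by omega)
  have key : ∀ i, i₀ ≤ i → i + q < r' → substLen (i + q) = substLen i + p →
      tribWord i = tribWord (i + q) := by
    intro i hi hir heq
    have h1 := hr2 _ hir
    have h2 := substLen_strictMono.monotone hi
    apply tribWord_eq_of_second_eq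
    rw [heq, h (substLen i + 1) (by omega) (by omega)]
    congr 1
    omega
  have fwd : ∀ i, i₀ ≤ i → i + q ≤ r' → substLen (i + q) = substLen i + p := by
    intro i hi
    induction i, hi using Nat.le_induction with
    | base => exact fun _ => hn₀.symm
    | succ i hi ih =>
      intro hir
      have h1 := ih (by omega)
      have h2 := substLen_succ_eq_of_eq (key i hi (by omega) h1)
      rw [show i + 1 + q = i + q + 1 by omega]
      omega
  have start : i₀ = s' + 1 → tribWord s' = tribWord (s' + q) ∧
      substLen (s' + q) = substLen s' + p := by
    intro hi
    obtain ⟨-, hs⟩ : i₀ = s' + 1 ∧ s = substLen s' + 1 := by omega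
    subst hi
    have h1 := h s le_rfl (by omega)
    have hne : tribWord s ≠ .a := by
      intro hc
      obtain ⟨n, hn⟩ := (tribWord_eq_a_iff _).1 hc
      have h2 : s' < n := substLen_strictMono.lt_iff_lt.1 (by omega)
      have h3 : n < s' + 1 := substLen_strictMono.lt_iff_lt.1 (by omega)
      omega
    have h4 := substLen_succ_eq (s' + q)
    rw [show s' + 1 + q = s' + q + 1 by omega] at hn₀
    have h5 : substLen (s' + q) = substLen s' + p := by
      rcases h4 with h4 | h4
      · exact absurd (h1.trans (by rw [show s + p = substLen (s' + q) by omega,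
          tribWord_substLen])) hne
      · omega
    refine ⟨tribWord_eq_of_second_eq ?_, h5⟩
    rw [← hs, h1]
    congr 1
    omega
  have hL : ∀ i, s' ≤ i → i + q ≤ r' → substLen (i + q) = substLen i + p := by
    intro i hi hir
    by_cases hc : i₀ ≤ i
    · exact fwd i hc hir
    · obtain rfl : i = s' := by omega
      exact (start (by omega)).2
  have hper : HasPeriodOn s' r' q := by
    intro i hi hir
    by_cases hc : i₀ ≤ i
    · exact key i hc hir (fwd i hc hir.le)
    · obtain rfl : i = s' := by omega
      exact (start (by omega)).1
  refine ⟨s', r', q, by omega, hper, ?_, hs1, hr1, hr2, hL⟩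
  have e1 := hL s' le_rfl (by omega)
  have hsr : s' + 2 * q ≤ r' := by
    by_contra hc
    have e2 := hL (r' - q) (by omega) (by omega)
    rw [Nat.sub_add_cancel (by omega)] at e2
    have := substLen_strictMono (show r' - q < s' + q by omega)
    omega
  by_contra hc
  have e2 := hL (r' - q) (by omega) (by omega)
  have e3 := hL (r' - q - q) (by omega) (by omega)
  rw [Nat.sub_add_cancel (by omega)] at e2 e3
  have e4 := substLen_add_two (r' - q - q)
  have e5 := substLen_strictMono.monotone (show r' - q - q + 2 ≤ s' + q by omega)
  omega

/-! ### Tribonacci numbers and palindromic prefix lengths -/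

lemma tribAux_add_three (n : ℕ) :
    tribAux (n + 3) = tribAux (n + 2) + tribAux (n + 1) + tribAux n := rfl

lemma one_le_tribAux (n : ℕ) : 1 ≤ tribAux (n + 1) := by
  induction n using Nat.strong_induction_on with
  | _ n ih =>
    match n with
    | 0 => simp [tribAux]
    | 1 => simp [tribAux]
    | n + 2 => have := ih (n + 1) (by omega); rw [tribAux_add_three n]; simp only [add_assoc, Nat.reduceAdd] at *; omega

lemma two_mul_palLen (i : ℕ) : 2 * palLen i + 3 = tribAux (i + 3) + tribAux (i + 1) := by
  have hodd : (tribAux (i + 3) + tribAux (i + 1)) % 2 = 1 := by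
    induction i using Nat.strong_induction_on with
    | _ i ih =>
      match i with
      | 0 => simp [tribAux]
      | 1 => simp [tribAux]
      | 2 => simp [tribAux]
      | i + 3 =>
        have h0 := ih i (by omega)
        have h1 := ih (i + 1) (by omega)
        have h2 := ih (i + 2) (by omega)
        rw [tribAux_add_three (i + 3), tribAux_add_three (i + 1)]
        simp only [add_assoc, Nat.reduceAdd] at *
        omega
  have h3 := tribAux_add_three i
  have h2 := one_le_tribAux (i + 1)
  rw [palLen]
  rcases i with _ | i
  · simp [tribAux]
  · have := one_le_tribAux i
    simp only [add_assoc, Nat.reduceAdd] at *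
    omega

lemma palLen_succ (i : ℕ) : palLen (i + 1) = tribAux (i + 2) + palLen i := by
  have h1 := two_mul_palLen i
  have h2 := two_mul_palLen (i + 1)
  have h4 := tribAux_add_three (i + 1)
  simp only [add_assoc, Nat.reduceAdd] at *
  omega

lemma palLen_add_three (i : ℕ) : palLen (i + 3) = tribAux (i + 5) + palLen i := by
  have h1 := palLen_succ i
  have h2 := palLen_succ (i + 1)
  have h3 := palLen_succ (i + 2)
  have h4 := tribAux_add_three (i + 2)
  simp only [add_assoc, Nat.reduceAdd] at *
  omega

lemma HasPeriodOn.substLen_prefix_add {i P : ℕ}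
    (h : HasPeriodOn 0 (palLen (i + 1)) (tribAux (i + 2)))
    (hP : substLen (tribAux (i + 2)) = P) {j : ℕ} (hj : j ≤ palLen i) :
    substLen (tribAux (i + 2) + j) = P + substLen j := by
  have := h.substLen_add (P := P) (by simp [hP, substLen]) (i := j) (Nat.zero_le _)
    (by rw [palLen_succ]; omega)
  rw [add_comm, this, add_comm]

lemma substLen_one : substLen 1 = 2 := by decide
lemma substLen_two : substLen 2 = 4 := by decide
lemma substLen_four : substLen 4 = 7 := by decide

lemma prefix_structure (i : ℕ) :
    HasPeriodOn 0 (palLen (i + 1)) (tribAux (i + 2)) ∧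
      substLen (tribAux (i + 2)) = tribAux (i + 3) ∧ substLen (palLen i) + 1 = palLen (i + 1) := by
  induction i using Nat.strong_induction_on with
  | _ i ih =>
    match i with
    | 0 =>
      refine ⟨fun j _ hj => ?_, substLen_one, rfl⟩
      simp [palLen, tribAux] at hj
    | i + 1 =>
      obtain ⟨h1, h2, h3⟩ := ih i (by omega)
      have hpal : substLen (palLen (i + 1)) + 1 = palLen (i + 2) := by
        rw [palLen_succ i, h1.substLen_prefix_add h2 le_rfl, palLen_succ (i + 1), add_assoc, h3]
      refine ⟨?_, ?_, hpal⟩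
      · have := h1.map_subst (P := tribAux (i + 3)) (by simp [h2, substLen])
        rwa [hpal] at this
      · match i with
        | 0 => exact substLen_two
        | 1 => exact substLen_four
        | i + 2 =>
          obtain ⟨g1, g2, -⟩ := ih (i + 1) (by omega)
          obtain ⟨-, f2, -⟩ := ih i (by omega)
          have e1 := palLen_succ (i + 1)
          have e2 := palLen_succ i
          simp only [add_assoc, Nat.reduceAdd] at *
          rw [tribAux_add_three (i + 2), tribAux_add_three (i + 3)]
          simp only [add_assoc, Nat.reduceAdd]
          rw [h1.substLen_prefix_add h2 (by omega), g1.substLen_prefix_add g2 (by omega), f2]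

lemma hasPeriodOn_palLen (i : ℕ) : HasPeriodOn 0 (palLen (i + 1)) (tribAux (i + 2)) :=
  (prefix_structure i).1

lemma substLen_tribAux (i : ℕ) : substLen (tribAux (i + 2)) = tribAux (i + 3) :=
  (prefix_structure i).2.1

lemma substLen_palLen (i : ℕ) : substLen (palLen i) + 1 = palLen (i + 1) :=
  (prefix_structure i).2.2

lemma substLen_tribAux_add (i : ℕ) {j : ℕ} (hj : j ≤ palLen i) :
    substLen (tribAux (i + 2) + j) = tribAux (i + 3) + substLen j :=
  (hasPeriodOn_palLen i).substLen_prefix_add (substLen_tribAux i) hj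

lemma tribAux_le_palLen_add_one (n : ℕ) : tribAux (n + 2) ≤ palLen n + 1 := by
  match n with
  | 0 => simp [tribAux]
  | 1 => simp [tribAux, palLen]
  | n + 2 =>
    have h1 := two_mul_palLen (n + 2)
    have h2 := tribAux_add_three n
    have h3 := tribAux_add_three (n + 1)
    have h4 := tribAux_add_three (n + 2)
    simp only [add_assoc, Nat.reduceAdd] at *
    omega

/-! ### The repetition straddling a palindromic prefix -/

lemma substLen_run_start (n : ℕ) :
    substLen (tribAux (n + 4) + tribAux (n + 3)) = tribAux (n + 5) + tribAux (n + 4) := by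
  have := palLen_succ (n + 1)
  simp only [add_assoc, Nat.reduceAdd] at *
  rw [substLen_tribAux_add (n + 2) (by omega), substLen_tribAux (n + 1)]

lemma substLen_run_mid (n : ℕ) :
    substLen (tribAux (n + 5) + tribAux (n + 2)) = tribAux (n + 6) + tribAux (n + 3) := by
  have := palLen_succ (n + 2)
  have := palLen_succ (n + 1)
  have := palLen_succ n
  simp only [add_assoc, Nat.reduceAdd] at *
  rw [substLen_tribAux_add (n + 3) (by omega), substLen_tribAux n]

lemma substLen_run_end (n : ℕ) :
    substLen (tribAux (n + 5) + (tribAux (n + 2) + palLen n)) + 1 =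
      tribAux (n + 6) + (tribAux (n + 3) + palLen (n + 1)) := by
  have := palLen_succ (n + 2)
  have := palLen_succ (n + 1)
  have := palLen_succ n
  simp only [add_assoc, Nat.reduceAdd] at *
  rw [substLen_tribAux_add (n + 3) (by omega), substLen_tribAux_add n le_rfl,
    ← substLen_palLen n]
  simp only [add_assoc, Nat.reduceAdd]

lemma hasPeriodOn_run (n : ℕ) :
    HasPeriodOn (tribAux (n + 4) + tribAux (n + 3))
      (tribAux (n + 5) + (tribAux (n + 2) + palLen n)) (tribAux (n + 2)) := by
  induction n with
  | zero =>
    intro j h1 h2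
    simp only [tribAux, palLen] at h1 h2 ⊢
    obtain rfl : j = 6 := by omega
    decide
  | succ n ih =>
    have h := ih.map_subst (P := tribAux (n + 3)) (by
      rw [substLen_run_start, show tribAux (n + 4) + tribAux (n + 3) + tribAux (n + 2) =
        tribAux (n + 5) from rfl, substLen_tribAux (n + 3)]
      rfl)
    rwa [substLen_run_start, substLen_run_end] at h

lemma straddling_base {s r p : ℕ} (hp : 1 ≤ p) (hs : s < 7) (hr : 7 < r) (hr2 : r ≤ 14)
    (hl : s + 3 * p ≤ r + 1) (h : HasPeriodOn s r p) : p = 1 ∧ 6 ≤ s ∧ r ≤ 8 := by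
  have hw : (List.range 14).map tribWord =
      [.a, .b, .a, .c, .a, .b, .a, .a, .b, .a, .c, .a, .b, .a] := by decide +kernel
  have key : ∀ s ∈ Finset.range 7, ∀ r ∈ Finset.range 15, ∀ p ∈ Finset.range 6,
      1 ≤ p ∧ 7 < r ∧ s + 3 * p ≤ r + 1 ∧ (∀ j ∈ Finset.range 14, s ≤ j ∧ j + p < r → ((List.range 14).map tribWord).getD j .a =
        ((List.range 14).map tribWord).getD (j + p) .a) → p = 1 ∧ 6 ≤ s ∧ r ≤ 8 := by
    rw [hw]
    decide +kernel
  simp only [Finset.mem_range] at key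
  refine key s hs r (by omega) p (by omega) ⟨hp, hr, hl, fun j hj ⟨hsj, hjr⟩ => ?_⟩
  have hjp : j + p < 14 := by omega
  simpa [List.getD_eq_getElem?_getD, hj, hjp] using h j hsj hjr

/-- The only factor that is at most one letter short of a cube and straddles the
palindromic prefix of length `palLen (n + 3)` lies in the run of period `tribAux (n + 2)`. -/
lemma straddling_unique (n : ℕ) {s r p : ℕ} (hp : 1 ≤ p) (hs : s < tribAux (n + 5))
    (hr : palLen (n + 3) < r) (hr2 : r ≤ palLen (n + 4)) (hl : s + 3 * p ≤ r + 1)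
    (h : HasPeriodOn s r p) :
    p = tribAux (n + 2) ∧ tribAux (n + 4) + tribAux (n + 3) ≤ s ∧
      r ≤ tribAux (n + 5) + (tribAux (n + 2) + palLen n) := by
  induction n generalizing s r p with
  | zero => exact straddling_base hp hs hr hr2 hl h
  | succ n ih =>
    have hp2 : 2 ≤ p := by
      by_contra hc
      obtain rfl : p = 1 := by omega
      have e1 := palLen_add_three (n + 1)
      have e2 := palLen_succ n
      have e3 := one_le_tribAux (n + 1)
      obtain ⟨j, hj⟩ : ∃ j, j + 1 = tribAux (n + 6) :=
        ⟨tribAux (n + 6) - 1, Nat.sub_add_cancel (one_le_tribAux (n + 5))⟩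
      simp only [add_assoc, Nat.reduceAdd] at *
      exact not_three_equal j ⟨h j (by omega) (by omega), h (j + 1) (by omega) (by omega)⟩
    obtain ⟨s', r', q, hq, hper, hl', hs1, hr1, hr3, hL⟩ := h.exists_desubst hp2 hl
    have a1 := substLen_tribAux (n + 3)
    have a2 := substLen_palLen (n + 3)
    have a3 := substLen_palLen (n + 4)
    simp only [add_assoc, Nat.reduceAdd] at *
    have b1 : s' < tribAux (n + 5) := substLen_strictMono.lt_iff_lt.1 (by omega)
    have b2 : palLen (n + 3) < r' := substLen_strictMono.lt_iff_lt.1 (by omega)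
    have b3 : r' ≤ palLen (n + 4) := by
      by_contra hc
      have := hr3 (palLen (n + 4)) (by omega)
      omega
    obtain ⟨rfl, c2, c3⟩ := ih hq b1 b2 b3 hl' hper
    have d1 := substLen_strictMono.monotone c2
    have d2 := substLen_strictMono.monotone c3
    have d3 := substLen_run_start n
    have d4 := substLen_run_end n
    have e1 := palLen_add_three n
    have e5 := tribAux_le_palLen_add_one n
    have d5 := hL (tribAux (n + 5)) b1.le (by omega)
    rw [substLen_run_mid, a1] at d5
    exact ⟨by omega, by omega, by omega⟩

/-! ### Counting cubes -/

/-- The cubes with a given range of end positions, as pairs of a start position and a period. -/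
def cubes (u v : ℕ) : Set (ℕ × ℕ) :=
  {q | 1 ≤ q.2 ∧ u < q.1 + 3 * q.2 ∧ q.1 + 3 * q.2 ≤ v ∧ HasPeriodOn q.1 (q.1 + 3 * q.2) q.2}

lemma finite_cubes (u v : ℕ) : (cubes u v).Finite := by
  refine ((Set.finite_Iic v).prod (Set.finite_Iic v)).subset ?_
  rintro ⟨x, p⟩ ⟨_, _, h, _⟩
  simp only [Set.mem_prod, Set.mem_Iic] at h ⊢
  omega

lemma ncard_cubes_add {u v w : ℕ} (huv : u ≤ v) (hvw : v ≤ w) :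
    (cubes u v).ncard + (cubes v w).ncard = (cubes u w).ncard := by
  rw [← Set.ncard_union_eq _ (finite_cubes _ _) (finite_cubes _ _)]
  · congr 1
    ext ⟨x, p⟩
    simp only [cubes, Set.mem_union, Set.mem_ofPred_eq]
    constructor
    · rintro (⟨h1, h2, h3, h4⟩ | ⟨h1, h2, h3, h4⟩)
      · exact ⟨h1, h2, by omega, h4⟩
      · exact ⟨h1, by omega, h3, h4⟩
    · rintro ⟨h1, h2, h3, h4⟩
      by_cases h : x + 3 * p ≤ v
      · exact .inl ⟨h1, h2, h, h4⟩
      · exact .inr ⟨h1, by omega, h3, h4⟩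
  · rw [Set.disjoint_left]
    rintro ⟨x, p⟩ ⟨_, _, h, _⟩ ⟨_, h', _, _⟩
    omega

lemma tribFactor_add (x l k : ℕ) :
    tribFactor x (l + k) = tribFactor x l ++ tribFactor (x + l) k := by
  simp [tribFactor, List.range_add, add_assoc]

lemma drop_tribFactor (n x : ℕ) : (tribFactor 0 n).drop x = tribFactor x (n - x) := by
  refine List.ext_getElem (by simp [tribFactor]) fun i h1 h2 => ?_
  simp [tribFactor]

lemma prefix_tribFactor_iff {w : List TLetter} {x l : ℕ} :
    w <+: tribFactor x l ↔ w.length ≤ l ∧ w = tribFactor x w.length := by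
  constructor
  · intro h
    have hl := h.length_le
    rw [length_tribFactor] at hl
    refine ⟨hl, ?_⟩
    obtain ⟨k, rfl⟩ := Nat.exists_eq_add_of_le hl
    obtain ⟨u, hu⟩ := h
    rw [tribFactor_add] at hu
    exact List.append_inj_left hu (length_tribFactor _ _).symm
  · rintro ⟨hl, h⟩
    obtain ⟨k, rfl⟩ := Nat.exists_eq_add_of_le hl
    exact ⟨tribFactor (x + w.length) k, by rw [tribFactor_add, ← h]⟩

lemma hasPeriodOn_iff_tribFactor (x l p : ℕ) :
    HasPeriodOn x (x + (l + p)) p ↔ tribFactor x l = tribFactor (x + p) l := by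
  simp only [tribFactor, List.map_inj_left, List.mem_range]
  constructor
  · intro h j hj
    rw [h (x + j) (by omega) (by omega)]
    congr 1
    omega
  · intro h j hj hjr
    have := h (j - x) (by omega)
    rwa [show x + (j - x) = j by omega, show x + p + (j - x) = j + p by omega] at this

lemma cube_eq_tribFactor_iff (w : List TLetter) (x : ℕ) :
    w ++ w ++ w = tribFactor x (3 * w.length) ↔
      w = tribFactor x w.length ∧ HasPeriodOn x (x + 3 * w.length) w.length := by
  generalize hp : w.length = p
  rw [show 3 * p = (p + p) + p by ring, hasPeriodOn_iff_tribFactor]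
  have e : tribFactor x (p + p) = tribFactor x p ++ tribFactor (x + p) p := tribFactor_add _ _ _
  have e' : tribFactor (x + p) (p + p) = tribFactor (x + p) p ++ tribFactor (x + p + p) p :=
    tribFactor_add _ _ _
  rw [tribFactor_add, e, e', ← add_assoc]
  constructor
  · intro h
    obtain ⟨h1, h2⟩ := List.append_inj h (by simp [hp, length_tribFactor])
    obtain ⟨h3, h4⟩ := List.append_inj h1 (by simp [hp, length_tribFactor])
    exact ⟨h3, by rw [← h2, ← h3, ← h4]⟩
  · rintro ⟨h1, h2⟩
    obtain ⟨h3, h4⟩ := List.append_inj h2 (by simp [length_tribFactor])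
    rw [← h4, ← h3, ← h1]

lemma D_eq_ncard_cubes (n : ℕ) : D n = (cubes 0 n).ncard := by
  have hinj : Function.Injective fun q : ℕ × ℕ => (tribFactor q.1 q.2, q.1 + 1) := by
    rintro ⟨x, p⟩ ⟨y, q⟩ h
    simp only [Prod.mk.injEq, Nat.add_right_cancel_iff] at h
    have := congrArg List.length h.1
    simp only [length_tribFactor] at this
    exact Prod.ext h.2 this
  rw [D, ← Set.ncard_image_of_injective _ hinj, ← Nat.card_coe_set_eq]
  refine Nat.card_congr (Equiv.subtypeEquivRight ?_)
  rintro ⟨w, i⟩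
  simp only [Set.mem_image, Prod.exists, Prod.mk.injEq, cubes, Set.mem_ofPred_eq]
  have hcube : (w ++ w ++ w).length = 3 * w.length := by simp; ring
  rw [TPrefix_eq, drop_tribFactor, prefix_tribFactor_iff, hcube, cube_eq_tribFactor_iff]
  constructor
  · rintro ⟨h1, h2, h3, h4, h5, h6⟩
    have hw := List.length_pos_iff.2 h1
    exact ⟨i - 1, w.length, ⟨hw, by omega, by omega, h6⟩, h5.symm, by omega⟩
  · rintro ⟨x, p, ⟨h1, h2, h3, h4⟩, rfl, rfl⟩
    simp only [length_tribFactor, Nat.add_sub_cancel]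
    refine ⟨fun h => ?_, by omega, by omega, by omega, trivial, h4⟩
    have := congrArg List.length h
    simp only [length_tribFactor, List.length_nil] at this
    omega

lemma palLen_mono : Monotone palLen :=
  monotone_nat_of_le_succ fun n => by rw [palLen_succ]; omega

lemma S_eq (k : ℕ) : S (k + 4) = (cubes (palLen (k + 3)) (palLen (k + 4))).ncard := by
  have h := ncard_cubes_add (Nat.zero_le _) (palLen_mono (show k + 3 ≤ k + 4 by omega))
  have h1 : t ((k : ℤ) + 4 + 1) = tribAux (k + 7) := by rw [t]; congr 1
  have h2 : t ((k : ℤ) + 4 - 1) = tribAux (k + 5) := by rw [t]; congr 1; omega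
  have h3 : t ((k : ℤ) + 4) = tribAux (k + 6) := by rw [t]; congr 1
  have h4 : t ((k : ℤ) + 4 - 2) = tribAux (k + 4) := by rw [t]; congr 1; omega
  rw [S, h1, h2, h3, h4, sub_eq_iff_eq_add]
  change (D (palLen (k + 4)) : ℚ) = _ + (D (palLen (k + 3)) : ℚ)
  rw [D_eq_ncard_cubes, D_eq_ncard_cubes, ← h]
  push_cast
  ring

/-- The straddling cubes, listed by their start positions. -/
lemma cubes_straddling (k : ℕ) :
    {q ∈ cubes (palLen (k + 6)) (palLen (k + 7)) | q.1 < tribAux (k + 8)} =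
      Set.image (fun j => (tribAux (k + 7) + tribAux (k + 6) + j, tribAux (k + 5)))
        (Set.Iic (palLen k)) := by
  have e2 := palLen_add_three k
  have e3 := palLen_succ (k + 3)
  have e4 := palLen_succ (k + 4)
  have e5 := palLen_succ (k + 5)
  have e6 := palLen_succ (k + 6)
  have e9 := two_mul_palLen k
  have e11 := tribAux_add_three (k + 2)
  have e13 := tribAux_add_three k
  have e14 := palLen_add_three (k + 3)
  have hrun := hasPeriodOn_run (k + 3)
  simp only [add_assoc, Nat.reduceAdd] at *
  ext ⟨x, p⟩
  simp only [cubes, Set.mem_ofPred_eq, Set.mem_image, Set.mem_Iic, Prod.mk.injEq]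
  constructor
  · rintro ⟨⟨h1, h2, h3, h4⟩, h5⟩
    obtain ⟨rfl, h6, h7⟩ := straddling_unique (k + 3) h1 h5 h2 h3 (by omega) h4
    simp only [add_assoc, Nat.reduceAdd] at h6 h7 ⊢
    exact ⟨x - (tribAux (k + 7) + tribAux (k + 6)), by omega, by omega, trivial⟩
  · rintro ⟨j, hj, rfl, rfl⟩
    exact ⟨⟨by omega, by omega, by omega, fun i hi1 hi2 => hrun i (by omega) (by omega)⟩,
      by omega⟩

/-- The remaining cubes are shifted copies of cubes ending earlier. -/
lemma cubes_not_straddling (k : ℕ) :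
    {q ∈ cubes (palLen (k + 6)) (palLen (k + 7)) | ¬ q.1 < tribAux (k + 8)} =
      Set.image (fun q : ℕ × ℕ => (tribAux (k + 8) + q.1, q.2))
        (cubes (palLen (k + 3)) (palLen (k + 6))) := by
  have e1 := palLen_succ (k + 6)
  have e2 := palLen_add_three (k + 3)
  have hper := hasPeriodOn_palLen (k + 6)
  simp only [add_assoc, Nat.reduceAdd] at *
  have shift : ∀ x p, x + 3 * p ≤ palLen (k + 6) →
      (HasPeriodOn (tribAux (k + 8) + x) (tribAux (k + 8) + x + 3 * p) p ↔
        HasPeriodOn x (x + 3 * p) p) := by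
    intro x p hx
    have hT : ∀ j < palLen (k + 6), tribWord (tribAux (k + 8) + j) = tribWord j := by
      intro j hj
      rw [add_comm]
      exact (hper j (Nat.zero_le _) (by omega)).symm
    constructor
    · intro h j h1 h2
      rw [← hT j (by omega), ← hT (j + p) (by omega), ← add_assoc]
      exact h _ (by omega) (by omega)
    · intro h j h1 h2
      obtain ⟨i, rfl⟩ : ∃ i, j = tribAux (k + 8) + i := ⟨j - tribAux (k + 8), by omega⟩
      rw [add_assoc, hT i (by omega), hT (i + p) (by omega)]
      exact h _ (by omega) (by omega)
  ext ⟨x, p⟩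
  simp only [cubes, Set.mem_ofPred_eq, Set.mem_image, Prod.mk.injEq, Prod.exists]
  constructor
  · rintro ⟨⟨h1, h2, h3, h4⟩, h5⟩
    obtain ⟨y, rfl⟩ : ∃ y, x = tribAux (k + 8) + y := ⟨x - tribAux (k + 8), by omega⟩
    exact ⟨y, p, ⟨h1, by omega, by omega, (shift y p (by omega)).1 h4⟩, rfl, rfl⟩
  · rintro ⟨y, p, ⟨h1, h2, h3, h4⟩, rfl, rfl⟩
    exact ⟨⟨h1, by omega, by omega, (shift y p (by omega)).2 h4⟩, by omega⟩

lemma ncard_cubes_eq (k : ℕ) :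
    (cubes (palLen (k + 6)) (palLen (k + 7))).ncard =
      (cubes (palLen (k + 3)) (palLen (k + 6))).ncard + (palLen k + 1) := by
  have hfin := finite_cubes (palLen (k + 6)) (palLen (k + 7))
  have hu : cubes (palLen (k + 6)) (palLen (k + 7)) =
      {q ∈ cubes (palLen (k + 6)) (palLen (k + 7)) | ¬ q.1 < tribAux (k + 8)} ∪
        {q ∈ cubes (palLen (k + 6)) (palLen (k + 7)) | q.1 < tribAux (k + 8)} := by
    ext q
    simp only [Set.mem_union, Set.mem_ofPred_eq]
    tauto
  rw [hu, Set.ncard_union_eq _ (hfin.subset (Set.sep_subset _ _))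
    (hfin.subset (Set.sep_subset _ _)), cubes_straddling, cubes_not_straddling,
    Set.ncard_image_of_injective, Set.ncard_image_of_injective]
  · simp [Set.ncard_eq_toFinset_card']
  · intro i j h
    simpa using h
  · rintro ⟨x, p⟩ ⟨y, q⟩ h
    simpa using h
  · rw [Set.disjoint_left]
    exact fun q h1 h2 => h1.2 h2.2

theorem S_recurrence (m : ℤ) (hm : 10 ≤ m) :
    S m = S (m - 1) + S (m - 2) + S (m - 3) +
      ((t (m - 2) : ℚ) - 3 * (t (m - 4) : ℚ) - 1) / 2 := by
  obtain ⟨k, rfl⟩ : ∃ k : ℕ, m = (k : ℤ) + 7 := ⟨(m - 7).toNat, by omega⟩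
  have h0 := S_eq k
  have h1 := S_eq (k + 1)
  have h2 := S_eq (k + 2)
  have h3 := S_eq (k + 3)
  have c1 := ncard_cubes_add (palLen_mono (show k + 3 ≤ k + 4 by omega))
    (palLen_mono (show k + 4 ≤ k + 5 by omega))
  have c2 := ncard_cubes_add (palLen_mono (show k + 3 ≤ k + 5 by omega))
    (palLen_mono (show k + 5 ≤ k + 6 by omega))
  have c3 := ncard_cubes_eq k
  have t1 : t ((k : ℤ) + 7 - 2) = tribAux (k + 7) := by rw [t]; congr 1; omega
  have t2 : t ((k : ℤ) + 7 - 4) = tribAux (k + 5) := by rw [t]; congr 1; omega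
  have e0 := two_mul_palLen k
  have e1 : tribAux (k + 7) = 2 * palLen k + 3 + 3 * tribAux (k + 5) := by
    have e2 := tribAux_add_three (k + 1)
    have e3 := tribAux_add_three (k + 2)
    have e4 := tribAux_add_three (k + 3)
    have e5 := tribAux_add_three (k + 4)
    simp only [add_assoc, Nat.reduceAdd] at *
    omega
  push_cast at h1 h2 h3
  simp only [add_assoc, Nat.reduceAdd, Int.reduceAdd] at *
  rw [show (k : ℤ) + 7 - 1 = k + 6 by ring, show (k : ℤ) + 7 - 3 = k + 4 by ring, t1, t2,
    show (k : ℤ) + 7 - 2 = k + 5 by ring, h0, h1, h2, h3, e1, c3, ← c2, ← c1]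
  push_cast
  ring
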